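/- arXiv:2201.00659 — 3 statements merged into one kernel-verified Lean document; each statement's English description precedes it below -/
import Mathlib

section
/- For every C^∞ function h : ℝ² → ℝ and every (u,v) ∈ I × ℝ, the ℝ³-valued identity (1/φ'(u))(∂h/∂u)(u,v)·x_u(u,v) + (1/(f(u) sin φ(u)))(∂h/∂v)(u,v)·x_v(u,v) + (1/φ'(u)²)(∂h/∂u)(u,v)·N_u(u,v) + (1/sin²φ(u))(∂h/∂v)(u,v)·N_v(u,v) = 0 holds, where subscripts u,v denote partial derivatives of the maps x and N. (This expresses the relation ∇^{II}(h,x) + ∇^{III}(h,N) = 0, using that the second fundamental form of x has coefficients b₁₁ = φ', b₁₂ = 0, b₂₂ = f sin φ and the third fundamental form has coefficients e₁₁ = φ'², e₁₂ = 0, e₂₂ = sin²φ.) -/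
open Real

/-- The surface of revolution `x(u,v) = (f(u) cos v, f(u) sin v, g(u))`. -/
noncomputable def xMap (f g : ℝ → ℝ) (u v : ℝ) : ℝ × ℝ × ℝ :=
  (f u * Real.cos v, f u * Real.sin v, g u)

/-- The Gauss map `N(u,v) = (−sin φ(u) cos v, −sin φ(u) sin v, cos φ(u))`. -/
noncomputable def nMap (φ : ℝ → ℝ) (u v : ℝ) : ℝ × ℝ × ℝ :=
  (-(Real.sin (φ u)) * Real.cos v, -(Real.sin (φ u)) * Real.sin v, Real.cos (φ u))

theorem hasDerivAt_xMap_left {f g : ℝ → ℝ} {f' g' u : ℝ} (hf : HasDerivAt f f' u)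
    (hg : HasDerivAt g g' u) (v : ℝ) :
    HasDerivAt (fun t => xMap f g t v) (f' * Real.cos v, f' * Real.sin v, g') u :=
  (hf.mul_const _).prodMk ((hf.mul_const _).prodMk hg)

theorem hasDerivAt_xMap_right (f g : ℝ → ℝ) (u v : ℝ) :
    HasDerivAt (fun t => xMap f g u t) (f u * -Real.sin v, f u * Real.cos v, 0) v :=
  ((Real.hasDerivAt_cos v).const_mul _).prodMk
    (((Real.hasDerivAt_sin v).const_mul _).prodMk (hasDerivAt_const v _))

theorem hasDerivAt_nMap_left {φ : ℝ → ℝ} {φ' u : ℝ} (hφ : HasDerivAt φ φ' u) (v : ℝ) :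
    HasDerivAt (fun t => nMap φ t v)
      (-(Real.cos (φ u) * φ') * Real.cos v, -(Real.cos (φ u) * φ') * Real.sin v,
        -Real.sin (φ u) * φ') u :=
  (hφ.sin.neg.mul_const _).prodMk ((hφ.sin.neg.mul_const _).prodMk hφ.cos)

theorem hasDerivAt_nMap_right (φ : ℝ → ℝ) (u v : ℝ) :
    HasDerivAt (fun t => nMap φ u t)
      (-Real.sin (φ u) * -Real.sin v, -Real.sin (φ u) * Real.cos v, 0) v :=
  ((Real.hasDerivAt_cos v).const_mul _).prodMk
    (((Real.hasDerivAt_sin v).const_mul _).prodMk (hasDerivAt_const v _))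

/-- the relation ∇^II(h,x) + ∇^III(h,N) = 0 for the surface of revolution. -/
theorem nablaII_x_add_nablaIII_N_eq_zero
    (a b : ℝ) (φ f g : ℝ → ℝ)
    (hφ : ContDiff ℝ (⊤ : ℕ∞) φ) (hf : ContDiff ℝ (⊤ : ℕ∞) f) (hg : ContDiff ℝ (⊤ : ℕ∞) g)
    (hfd : ∀ u ∈ Set.Ioo a b, deriv f u = Real.cos (φ u))
    (hgd : ∀ u ∈ Set.Ioo a b, deriv g u = Real.sin (φ u))
    (hfpos : ∀ u ∈ Set.Ioo a b, 0 < f u)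
    (hsin : ∀ u ∈ Set.Ioo a b, Real.sin (φ u) ≠ 0)
    (hφd : ∀ u ∈ Set.Ioo a b, deriv φ u ≠ 0)
    (h : ℝ → ℝ → ℝ) (hh : ContDiff ℝ (⊤ : ℕ∞) (Function.uncurry h)) :
    ∀ u ∈ Set.Ioo a b, ∀ v : ℝ,
      ((1 / deriv φ u) * deriv (fun t => h t v) u) • deriv (fun t => xMap f g t v) u
        + ((1 / (f u * Real.sin (φ u))) * deriv (fun t => h u t) v) •
            deriv (fun t => xMap f g u t) v
        + ((1 / (deriv φ u) ^ 2) * deriv (fun t => h t v) u) • deriv (fun t => nMap φ t v) u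
        + ((1 / Real.sin (φ u) ^ 2) * deriv (fun t => h u t) v) •
            deriv (fun t => nMap φ u t) v
      = (0 : ℝ × ℝ × ℝ) := by
  intro u hu v
  have hf' := (hf.differentiable (by simp) u).hasDerivAt
  have hg' := (hg.differentiable (by simp) u).hasDerivAt
  have hφ' := (hφ.differentiable (by simp) u).hasDerivAt
  rw [hfd u hu] at hf'
  rw [hgd u hu] at hg'
  rw [(hasDerivAt_xMap_left hf' hg' v).deriv, (hasDerivAt_xMap_right f g u v).deriv,
    (hasDerivAt_nMap_left hφ' v).deriv, (hasDerivAt_nMap_right φ u v).deriv]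
  have hf0 := (hfpos u hu).ne'
  have hs0 := hsin u hu
  have hφ0 := hφd u hu
  simp only [Prod.smul_mk, Prod.mk_add_mk, smul_eq_mul, Prod.mk_eq_zero]
  refine ⟨?_, ?_, ?_⟩ <;> field_simp <;> ring
end

section
/- If in addition φ'(u) = −sin φ(u)/f(u) for all u ∈ I (i.e. the mean curvature H = (φ' + sin φ/f)/2 vanishes, so the surface is minimal), then the support function W is an eigenfunction of Δ^{III} with eigenvalue 2: Δ^{III} W = 2W at every point of I × ℝ. -/
open Real

/-- The Laplace operator of the third fundamental form:
`Δ^III h = −(1/φ'²) h_uu + (φ''/φ'³ − cos φ/(φ' sin φ)) h_u − (1/sin² φ) h_vv`. -/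
noncomputable def lapIII (φ : ℝ → ℝ) (h : ℝ → ℝ → ℝ) : ℝ → ℝ → ℝ := fun u v =>
  -(1 / (deriv φ u) ^ 2) * deriv (deriv (fun s => h s v)) u
    + (deriv (deriv φ) u / (deriv φ u) ^ 3
        - Real.cos (φ u) / (deriv φ u * Real.sin (φ u))) * deriv (fun s => h s v) u
    - (1 / Real.sin (φ u) ^ 2) * deriv (deriv (fun s => h u s)) v

/-- The support function `W = −⟨x, N⟩ = f sin φ − g cos φ`. -/
noncomputable def Wsup (φ f g : ℝ → ℝ) (u : ℝ) : ℝ :=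
  f u * Real.sin (φ u) - g u * Real.cos (φ u)

theorem hasDerivAt_Wsup {φ f g : ℝ → ℝ} {u φ' : ℝ} (hφ : HasDerivAt φ φ' u)
    (hf : HasDerivAt f (cos (φ u)) u) (hg : HasDerivAt g (sin (φ u)) u) :
    HasDerivAt (Wsup φ f g) (φ' * (f u * cos (φ u) + g u * sin (φ u))) u := by
  refine ((hf.mul hφ.sin).sub (hg.mul hφ.cos)).congr_deriv ?_
  ring

theorem hasDerivAt_mul_cos_add_mul_sin {φ f g : ℝ → ℝ} {u φ' : ℝ} (hφ : HasDerivAt φ φ' u)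
    (hf : HasDerivAt f (cos (φ u)) u) (hg : HasDerivAt g (sin (φ u)) u) :
    HasDerivAt (fun s => f s * cos (φ s) + g s * sin (φ s)) (1 - φ' * Wsup φ f g u) u := by
  refine ((hf.mul hφ.cos).add (hg.mul hφ.sin)).congr_deriv ?_
  rw [Wsup]
  linear_combination sin_sq_add_cos_sq (φ u)

/-- for a minimal surface of revolution, Δ^III W = 2W (Corollary 1). -/
theorem lapIII_support_eq_two_W_of_minimal
    (a b : ℝ) (φ f g : ℝ → ℝ)
    (hφ : ContDiff ℝ (⊤ : ℕ∞) φ) (hf : ContDiff ℝ (⊤ : ℕ∞) f) (hg : ContDiff ℝ (⊤ : ℕ∞) g)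
    (hfd : ∀ u ∈ Set.Ioo a b, deriv f u = Real.cos (φ u))
    (hgd : ∀ u ∈ Set.Ioo a b, deriv g u = Real.sin (φ u))
    (hfpos : ∀ u ∈ Set.Ioo a b, 0 < f u)
    (hsin : ∀ u ∈ Set.Ioo a b, Real.sin (φ u) ≠ 0)
    (hφd : ∀ u ∈ Set.Ioo a b, deriv φ u ≠ 0)
    (hmin : ∀ u ∈ Set.Ioo a b, deriv φ u = -(Real.sin (φ u)) / f u) :
    ∀ u ∈ Set.Ioo a b, ∀ v : ℝ,
      lapIII φ (fun s _ => Wsup φ f g s) u v = 2 * Wsup φ f g u := by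
  intro u hu v
  have hφ' : ∀ s, HasDerivAt φ (deriv φ s) s := fun s =>
    (hφ.differentiable (by simp) s).hasDerivAt
  have hf' : ∀ s ∈ Set.Ioo a b, HasDerivAt f (cos (φ s)) s := fun s hs =>
    hfd s hs ▸ (hf.differentiable (by simp) s).hasDerivAt
  have hg' : ∀ s ∈ Set.Ioo a b, HasDerivAt g (sin (φ s)) s := fun s hs =>
    hgd s hs ▸ (hg.differentiable (by simp) s).hasDerivAt
  have hφ'' : HasDerivAt (deriv φ) (deriv (deriv φ) u) u :=
    (((contDiff_infty_iff_deriv.1 hφ).2).differentiable (by simp) u).hasDerivAt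
  have hW : ∀ s ∈ Set.Ioo a b, deriv (fun s => Wsup φ f g s) s =
      deriv φ s * (f s * cos (φ s) + g s * sin (φ s)) := fun s hs =>
    (hasDerivAt_Wsup (hφ' s) (hf' s hs) (hg' s hs)).deriv
  have hW' : deriv (deriv (fun s => Wsup φ f g s)) u =
      deriv (deriv φ) u * (f u * cos (φ u) + g u * sin (φ u)) +
        deriv φ u * (1 - deriv φ u * Wsup φ f g u) := by
    rw [Filter.EventuallyEq.deriv_eq (Filter.eventually_of_mem (isOpen_Ioo.mem_nhds hu) hW)]
    exact (hφ''.mul (hasDerivAt_mul_cos_add_mul_sin (hφ' u) (hf' u hu) (hg' u hu))).deriv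
  have hd := hφd u hu
  have hs := hsin u hu
  have hmean : deriv φ u * f u = -sin (φ u) := by
    rw [hmin u hu, div_mul_cancel₀ _ (hfpos u hu).ne']
  simp only [lapIII, hW', hW u hu, deriv_const', mul_zero, sub_zero]
  rw [Wsup]
  field_simp
  linear_combination -deriv φ u * hmean - deriv φ u ^ 2 * f u * sin_sq_add_cos_sq (φ u)
end

section
/- If R(u) = c for all u ∈ I (c ∈ ℝ a constant), then Δ^{III} x = −c N componentwise at every point of I × ℝ. In particular, a minimal surface of revolution (c = 0) satisfies Δ^{III} x = 0, i.e. it is of finite null III-type 1. -/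
open Real

/-- The sum of the principal radii of curvature `R = f/sin φ + 1/φ'`. -/
noncomputable def Rsum (φ f : ℝ → ℝ) (u : ℝ) : ℝ :=
  f u / Real.sin (φ u) + 1 / deriv φ u

/-- If `R` is constant near `u`, the coefficient of `∂h/∂u` in `lapIII` is `-f cos φ / sin² φ`. -/
lemma lapIII_coeff_eq_of_Rsum_eventually_const {φ f : ℝ → ℝ} {u c : ℝ}
    (hφ : DifferentiableAt ℝ φ u) (hφ' : DifferentiableAt ℝ (deriv φ) u)
    (hf : HasDerivAt f (Real.cos (φ u)) u) (hsin : Real.sin (φ u) ≠ 0) (hφd : deriv φ u ≠ 0)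
    (hR : Rsum φ f =ᶠ[nhds u] fun _ => c) :
    deriv (deriv φ) u / (deriv φ u) ^ 3 - Real.cos (φ u) / (deriv φ u * Real.sin (φ u))
      = -(f u * Real.cos (φ u) / Real.sin (φ u) ^ 2) := by
  have hR' := (hf.div hφ.hasDerivAt.sin hsin).add ((hasDerivAt_const u (1 : ℝ)).div
    hφ'.hasDerivAt hφd)
  have hzero := (hR'.congr_of_eventuallyEq hR.symm).unique
    (hasDerivAt_const u c)
  field_simp at hzero ⊢
  linear_combination -hzero

/-- The value of `lapIII` at a product of a function of `u` and a function of `v`, from the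
derivatives of the factors. -/
lemma lapIII_mul {φ p p' q q' : ℝ → ℝ} {u v p'' q'' : ℝ}
    (hp : ∀ᶠ s in nhds u, deriv p s = p' s) (hp' : HasDerivAt p' p'' u)
    (hq : deriv q = q') (hq' : HasDerivAt q' q'' v) :
    lapIII φ (fun s t => p s * q t) u v
      = -(1 / (deriv φ u) ^ 2) * (p'' * q v)
        + (deriv (deriv φ) u / (deriv φ u) ^ 3
            - Real.cos (φ u) / (deriv φ u * Real.sin (φ u))) * (p' u * q v)
        - (1 / Real.sin (φ u) ^ 2) * (p u * q'') := by
  have hpp : deriv (deriv p) u = p'' := (Filter.EventuallyEq.deriv_eq hp).trans hp'.deriv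
  simp only [lapIII, deriv_mul_const_field', deriv_mul_const_field, deriv_const_mul_field',
    deriv_const_mul_field, hpp, hp.self_of_nhds, hq, hq'.deriv]

/-- if R ≡ c then Δ^III x = −c N componentwise (in particular, a minimal
surface of revolution satisfies Δ^III x = 0, i.e. it is of finite null III-type 1). -/
theorem lapIII_x_eq_neg_c_N_of_R_const
    (a b : ℝ) (φ f g : ℝ → ℝ)
    (hφ : ContDiff ℝ (⊤ : ℕ∞) φ) (hf : ContDiff ℝ (⊤ : ℕ∞) f) (hg : ContDiff ℝ (⊤ : ℕ∞) g)
    (hfd : ∀ u ∈ Set.Ioo a b, deriv f u = Real.cos (φ u))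
    (hgd : ∀ u ∈ Set.Ioo a b, deriv g u = Real.sin (φ u))
    (hfpos : ∀ u ∈ Set.Ioo a b, 0 < f u)
    (hsin : ∀ u ∈ Set.Ioo a b, Real.sin (φ u) ≠ 0)
    (hφd : ∀ u ∈ Set.Ioo a b, deriv φ u ≠ 0)
    (c : ℝ) (hR : ∀ u ∈ Set.Ioo a b, Rsum φ f u = c) :
    ∀ u ∈ Set.Ioo a b, ∀ v : ℝ,
      lapIII φ (fun s t => f s * Real.cos t) u v = -c * (-(Real.sin (φ u)) * Real.cos v)
        ∧ lapIII φ (fun s t => f s * Real.sin t) u v = -c * (-(Real.sin (φ u)) * Real.sin v)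
        ∧ lapIII φ (fun s _ => g s) u v = -c * Real.cos (φ u) := by
  intro u hu v
  have hI : ∀ᶠ s in nhds u, s ∈ Set.Ioo a b := isOpen_Ioo.mem_nhds hu
  have hφu : DifferentiableAt ℝ φ u := (hφ.differentiable (by simp)).differentiableAt
  have hφ'u : DifferentiableAt ℝ (deriv φ) u :=
    ((contDiff_infty_iff_deriv.mp hφ).2.differentiable (by simp)).differentiableAt
  have hfu : HasDerivAt f (Real.cos (φ u)) u :=
    hfd u hu ▸ (hf.differentiable (by simp)).differentiableAt.hasDerivAt
  have hs := hsin u hu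
  have hd := hφd u hu
  have hcoeff := lapIII_coeff_eq_of_Rsum_eventually_const hφu hφ'u hfu hs hd (hI.mono hR)
  have hc : c = f u / Real.sin (φ u) + 1 / deriv φ u := (hR u hu).symm
  have hcos := hφu.hasDerivAt.cos
  refine ⟨?_, ?_, ?_⟩
  · rw [lapIII_mul (hI.mono hfd) hcos Real.deriv_cos' (Real.hasDerivAt_sin v).neg, hcoeff, hc]
    field_simp
    rw [Real.cos_sq' (φ u)]
    ring
  · rw [lapIII_mul (hI.mono hfd) hcos Real.deriv_sin (Real.hasDerivAt_cos v), hcoeff, hc]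
    field_simp
    rw [Real.cos_sq' (φ u)]
    ring
  · have h := lapIII_mul (φ := φ) (hI.mono hgd) hφu.hasDerivAt.sin (deriv_const' (1 : ℝ))
      (hasDerivAt_const v (0 : ℝ))
    simp only [mul_one] at h
    rw [h, hcoeff, hc]
    field_simp
    ring
end
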